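/- Let g be a non-constant entire function with non-negative Taylor coefficients and finite order ρ ≥ 0. Then f = e^g (which belongs to 𝒦, is entire, and has fulcrum F(s) = g(e^s)) is Gaussian: its normalized Khinchin family X̆_t converges in distribution to the standard normal N(0,1) as t → +∞; moreover lim_{s→+∞} F^{(k)}(s)/F″(s)^{k/2} = 0 for every integer k ≥ 3, and every integer moment of X̆_t converges, as t → +∞, to the corresponding moment of a standard normal random variable. -/

import Mathlib

open scoped BigOperators Topology
open Filter

namespace KhinchinPaper

/-- Sum of the power series with coefficients `a` at `t`. -/
noncomputable def fsum (a : ℕ → ℝ) (t : ℝ) : ℝ := ∑' n : ℕ, a n * t ^ n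

/-- The class `𝒦`: non-constant power series with non-negative coefficients, `a 0 > 0`,
and radius of convergence `R > 0`. -/
structure IsK (a : ℕ → ℝ) (R : ℝ) : Prop where
  pos₀ : 0 < a 0
  nonneg : ∀ n, 0 ≤ a n
  nonconst : ∃ n, 0 < n ∧ 0 < a n
  Rpos : 0 < R
  conv : ∀ t : ℝ, 0 ≤ t → t < R → Summable fun n : ℕ => a n * t ^ n
  radius : ∀ t : ℝ, R < t → ¬ Summable fun n : ℕ => a n * t ^ n

/-- Mean function `m_f(t) = t f'(t)/f(t)`. -/
noncomputable def mf (a : ℕ → ℝ) (t : ℝ) : ℝ :=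
  (∑' n : ℕ, (n : ℝ) * a n * t ^ n) / fsum a t

/-- Variance function `σ_f²(t)`. -/
noncomputable def sigma2 (a : ℕ → ℝ) (t : ℝ) : ℝ :=
  (∑' n : ℕ, (n : ℝ) ^ 2 * a n * t ^ n) / fsum a t - (mf a t) ^ 2

noncomputable def sigma (a : ℕ → ℝ) (t : ℝ) : ℝ := Real.sqrt (sigma2 a t)

/-- `k`-th moment of the normalized Khinchin family variable `X̆_t`. -/
noncomputable def normMoment (a : ℕ → ℝ) (t : ℝ) (k : ℕ) : ℝ :=
  ∑' n : ℕ, (a n * t ^ n / fsum a t) * (((n : ℝ) - mf a t) / sigma a t) ^ k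

/-- `k`-th central moment of `X_t`. -/
noncomputable def centralMoment (a : ℕ → ℝ) (t : ℝ) (k : ℕ) : ℝ :=
  ∑' n : ℕ, (a n * t ^ n / fsum a t) * ((n : ℝ) - mf a t) ^ k

/-- Characteristic function `E(e^{iθ X̆_t})` of the normalized variable. -/
noncomputable def charfun (a : ℕ → ℝ) (t θ : ℝ) : ℂ :=
  ∑' n : ℕ, ((a n * t ^ n / fsum a t : ℝ) : ℂ) *
    Complex.exp (Complex.I * (θ : ℂ) * ((((n : ℝ) - mf a t) / sigma a t : ℝ) : ℂ))

/-- `f` is Gaussian: `X̆_t → N(0,1)` in distribution as `t ↑ R`, expressed via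
pointwise convergence of characteristic functions (Lévy's continuity theorem). -/
def IsGaussian (a : ℕ → ℝ) (R : ℝ) : Prop :=
  ∀ θ : ℝ, Tendsto (fun t => charfun a t θ) (𝓝[<] R)
    (𝓝 (Complex.exp (-(θ : ℂ) ^ 2 / 2)))

/-- Gaussian for entire `f` (radius `R = ∞`, so `t → +∞`). -/
def IsGaussianEntire (a : ℕ → ℝ) : Prop :=
  ∀ θ : ℝ, Tendsto (fun t => charfun a t θ) atTop
    (𝓝 (Complex.exp (-(θ : ℂ) ^ 2 / 2)))

/-- The fulcrum `F(s) = log f(e^s)` restricted to the real axis. -/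
noncomputable def fulcrum (a : ℕ → ℝ) (s : ℝ) : ℝ := Real.log (fsum a (Real.exp s))

/-- The quotient `F^{(j)}(s) / F''(s)^{j/2}`. -/
noncomputable def Fq (a : ℕ → ℝ) (j : ℕ) (s : ℝ) : ℝ :=
  iteratedDeriv j (fulcrum a) s / (iteratedDeriv 2 (fulcrum a) s) ^ ((j : ℝ) / 2)

/-- Tuples `(m₂, …, m_n)` of non-negative integers with `2m₂ + ⋯ + n m_n = n`,
padded with `m₀ = m₁ = 0` and encoded as functions on `Fin (n+1)`. -/
def tuples (n : ℕ) : Finset (Fin (n + 1) → ℕ) :=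
  (Fintype.piFinset fun _ : Fin (n + 1) => Finset.range (n + 1)).filter
    fun m => m 0 = 0 ∧ m 1 = 0 ∧ ∑ j : Fin (n + 1), (j : ℕ) * m j = n

/-- Integer moments of a standard normal random variable `Z`. -/
noncomputable def gaussMoment (k : ℕ) : ℝ :=
  if Even k then (Nat.factorial k : ℝ) / ((Nat.factorial (k / 2) : ℝ) * 2 ^ (k / 2)) else 0

/-- The complex power series sum. -/
noncomputable def fsumC (a : ℕ → ℝ) (z : ℂ) : ℂ := ∑' n : ℕ, (a n : ℂ) * z ^ n

/-- The complex fulcrum `F(z) = log f(e^z)`. -/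
noncomputable def fulcrumC (a : ℕ → ℝ) (z : ℂ) : ℂ := Complex.log (fsumC a (Complex.exp z))

end KhinchinPaper

/-- The general Dirichlet-type series `∑ pₙ exp (u xₙ)`. -/
noncomputable def expSeries (p : ℕ → ℂ) (x : ℕ → ℝ) (u : ℂ) : ℂ :=
  ∑' n, p n * Complex.exp (u * x n)

/-- The series `∑ pₙ exp (u xₙ)` converges absolutely for all `u`. -/
def ExpSummable (p : ℕ → ℂ) (x : ℕ → ℝ) : Prop :=
  ∀ r : ℝ, Summable fun n => ‖p n‖ * Real.exp (r * |x n|)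

theorem norm_expSeries_term_le (p : ℕ → ℂ) (x : ℕ → ℝ) {u : ℂ} {r : ℝ} (hu : ‖u‖ ≤ r) (n : ℕ) :
    ‖p n * Complex.exp (u * x n)‖ ≤ ‖p n‖ * Real.exp (r * |x n|) := by
  rw [norm_mul]
  gcongr
  refine (Complex.norm_exp_le_exp_norm _).trans (Real.exp_le_exp.2 ?_)
  rw [norm_mul, Complex.norm_real, Real.norm_eq_abs]
  gcongr

theorem ExpSummable.mul_exponent {p : ℕ → ℂ} {x : ℕ → ℝ} (h : ExpSummable p x) :
    ExpSummable (fun n => p n * x n) x := by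
  intro r
  refine (h (r + 1)).of_nonneg_of_le (fun n => by positivity) fun n => ?_
  rw [norm_mul, Complex.norm_real, Real.norm_eq_abs, add_mul, Real.exp_add, mul_assoc, one_mul,
    mul_comm |x n|]
  gcongr
  linarith [Real.add_one_le_exp |x n|]

theorem ExpSummable.mul_exponent_pow {p : ℕ → ℂ} {x : ℕ → ℝ} (h : ExpSummable p x) (k : ℕ) :
    ExpSummable (fun n => p n * (x n : ℂ) ^ k) x := by
  induction k with
  | zero => simpa using h
  | succ k ih => simpa only [pow_succ, mul_assoc] using ih.mul_exponent

theorem ExpSummable.summable {p : ℕ → ℂ} {x : ℕ → ℝ} (h : ExpSummable p x) (u : ℂ) :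
    Summable fun n => p n * Complex.exp (u * x n) :=
  (h ‖u‖).of_norm_bounded (norm_expSeries_term_le p x le_rfl)

theorem ExpSummable.hasDerivAt {p : ℕ → ℂ} {x : ℕ → ℝ} (h : ExpSummable p x) (u : ℂ) :
    HasDerivAt (expSeries p x) (expSeries (fun n => p n * x n) x u) u := by
  have hU : IsOpen (Metric.ball (0 : ℂ) (‖u‖ + 1)) := Metric.isOpen_ball
  have hu : u ∈ Metric.ball (0 : ℂ) (‖u‖ + 1) := by simp
  have hd : ∀ n w, HasDerivAt (fun w : ℂ => p n * Complex.exp (w * x n))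
      (p n * x n * Complex.exp (w * x n)) w := fun n w => by
    exact ((((hasDerivAt_id' w).mul_const (x n : ℂ)).cexp).const_mul (p n)).congr_deriv (by ring)
  have hdiff : ∀ n, DifferentiableOn ℂ (fun w : ℂ => p n * Complex.exp (w * x n))
      (Metric.ball (0 : ℂ) (‖u‖ + 1)) :=
    fun n w _ => (hd n w).differentiableAt.differentiableWithinAt
  have hle : ∀ n, ∀ w ∈ Metric.ball (0 : ℂ) (‖u‖ + 1),
      ‖p n * Complex.exp (w * x n)‖ ≤ ‖p n‖ * Real.exp ((‖u‖ + 1) * |x n|) := fun n w hw =>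
    norm_expSeries_term_le p x (by simpa using (mem_ball_zero_iff.1 hw).le) n
  have h1 := Complex.differentiableOn_tsum_of_summable_norm (h (‖u‖ + 1)) hdiff hU hle
  have h2 := Complex.hasSum_deriv_of_summable_norm (h (‖u‖ + 1)) hdiff hU hle hu
  have h3 := (h1.differentiableAt (hU.mem_nhds hu)).hasDerivAt
  rw [← h2.tsum_eq] at h3
  simp only [(hd _ _).deriv] at h3
  exact h3

theorem ExpSummable.differentiable {p : ℕ → ℂ} {x : ℕ → ℝ} (h : ExpSummable p x) :
    Differentiable ℂ (expSeries p x) := fun u => (h.hasDerivAt u).differentiableAt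

theorem ExpSummable.iteratedDeriv_eq {p : ℕ → ℂ} {x : ℕ → ℝ} (h : ExpSummable p x) (k : ℕ) :
    iteratedDeriv k (expSeries p x) = expSeries (fun n => p n * (x n : ℂ) ^ k) x := by
  induction k with
  | zero => simp
  | succ k ih =>
    funext u
    rw [iteratedDeriv_succ, ih, ((h.mul_exponent_pow k).hasDerivAt u).deriv]
    simp only [pow_succ, mul_assoc]

theorem ExpSummable.iteratedDeriv_re_eq {p : ℕ → ℂ} {x : ℕ → ℝ} (h : ExpSummable p x) (k : ℕ) :
    iteratedDeriv k (fun s : ℝ => (expSeries p x s).re) =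
      fun s : ℝ => (expSeries (fun n => p n * (x n : ℂ) ^ k) x s).re := by
  induction k with
  | zero => simp
  | succ k ih =>
    funext u
    rw [iteratedDeriv_succ, ih, ((h.mul_exponent_pow k).hasDerivAt u).real_of_complex.deriv]
    simp only [pow_succ, mul_assoc]

theorem expSeries_zero (p : ℕ → ℂ) (x : ℕ → ℝ) : expSeries p x 0 = ∑' n, p n := by
  simp [expSeries]

/-- Iterated derivatives of order at least two do not see an affine function. -/
theorem ExpSummable.iteratedDeriv_sub_affine {p : ℕ → ℂ} {x : ℕ → ℝ} (h : ExpSummable p x)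
    (α β : ℂ) (k : ℕ) :
    iteratedDeriv (k + 2) (fun u => expSeries p x u - α - u * β) =
      expSeries (fun n => p n * (x n : ℂ) ^ (k + 2)) x := by
  have h1 : deriv (fun u => expSeries p x u - α - u * β) =
      fun u => deriv (expSeries p x) u - β := by
    funext u
    refine HasDerivAt.deriv ?_
    exact (((h.differentiable u).hasDerivAt.sub_const α).sub
      ((hasDerivAt_id' u).mul_const β)).congr_deriv (by rw [one_mul])
  have h2 : deriv (fun u => deriv (expSeries p x) u - β) = deriv (deriv (expSeries p x)) := by
    funext u
    rw [deriv_sub_const]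
  rw [← h.iteratedDeriv_eq, iteratedDeriv_succ', iteratedDeriv_succ', h1, h2, iteratedDeriv_succ',
    iteratedDeriv_succ']

theorem TendstoLocallyUniformlyOn.iteratedDeriv_univ {ι : Type*} {φ : Filter ι} [φ.NeBot]
    {F : ι → ℂ → ℂ} {f : ℂ → ℂ} (hf : TendstoLocallyUniformlyOn F f φ Set.univ)
    (hF : ∀ᶠ i in φ, Differentiable ℂ (F i)) (k : ℕ) :
    TendstoLocallyUniformlyOn (fun i => iteratedDeriv k (F i)) (iteratedDeriv k f) φ Set.univ := by
  induction k with
  | zero => simpa using hf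
  | succ k ih =>
    simp only [iteratedDeriv_succ]
    refine ih.deriv ?_ isOpen_univ
    filter_upwards [hF] with i hi
    exact ((hi.contDiff (n := ((k + 1 : ℕ) : ℕ∞))).differentiable_iteratedDeriv k
      (by exact_mod_cast Nat.lt_succ_self k)).differentiableOn

theorem iteratedDeriv_gaussian_add_two (m : ℕ) :
    iteratedDeriv (m + 2) (fun u : ℂ => Complex.exp (u ^ 2 / 2)) = fun u =>
      u * iteratedDeriv (m + 1) (fun u : ℂ => Complex.exp (u ^ 2 / 2)) u +
        (m + 1) * iteratedDeriv m (fun u : ℂ => Complex.exp (u ^ 2 / 2)) u := by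
  set h : ℂ → ℂ := fun u => Complex.exp (u ^ 2 / 2) with hh
  have hd : Differentiable ℂ h := by fun_prop
  have hdk : ∀ k u, HasDerivAt (iteratedDeriv k h) (iteratedDeriv (k + 1) h u) u := fun k u => by
    rw [iteratedDeriv_succ]
    exact ((hd.contDiff (n := ((k + 1 : ℕ) : ℕ∞))).differentiable_iteratedDeriv k
      (by exact_mod_cast Nat.lt_succ_self k) u).hasDerivAt
  have h1 : iteratedDeriv 1 h = fun u => u * h u := by
    funext u
    rw [iteratedDeriv_one]
    refine HasDerivAt.deriv ?_
    exact ((((hasDerivAt_id' u).pow 2).div_const 2).cexp).congr_deriv (by simp [hh]; ring)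
  induction m with
  | zero =>
    funext u
    rw [iteratedDeriv_succ]
    have : deriv (iteratedDeriv 1 h) u = 1 * h u + u * iteratedDeriv 1 h u := by
      conv_lhs => rw [h1]
      have := hdk 0 u
      rw [iteratedDeriv_zero] at this
      exact ((hasDerivAt_id u).mul this).deriv
    rw [this]
    simp only [iteratedDeriv_zero, Nat.cast_zero, zero_add]
    ring
  | succ m ih =>
    funext u
    conv_lhs => rw [iteratedDeriv_succ, ih]
    refine (((hasDerivAt_id' u).mul (hdk (m + 1) u)).add
      ((hdk m u).const_mul ((m : ℂ) + 1))).congr_deriv ?_ |>.deriv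
    push_cast
    ring

theorem iteratedDeriv_sq_div_two_add_three (k : ℕ) :
    iteratedDeriv (k + 3) (fun u : ℂ => u ^ 2 / 2) = 0 := by
  have h1 : deriv (fun u : ℂ => u ^ 2 / 2) = fun u => u := by
    funext u
    simp
  have h2 : deriv (fun u : ℂ => u) = fun _ => 1 := by funext u; simp
  have h3 : deriv (fun _ : ℂ => (1 : ℂ)) = fun _ => 0 := by funext u; simp
  rw [iteratedDeriv_succ', iteratedDeriv_succ', iteratedDeriv_succ', h1, h2, h3]
  funext u
  simp

namespace KhinchinPaper

section GrowthBounds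

variable {c : ℕ → ℝ}

theorem summable_pow_mul (hc : ∀ n, 0 ≤ c n)
    (hent : ∀ t : ℝ, Summable fun n : ℕ => c n * t ^ n) (k : ℕ) {t : ℝ} (ht : 0 ≤ t) :
    Summable fun n : ℕ => (n : ℝ) ^ k * c n * t ^ n := by
  refine ((hent (Real.exp 1 * t)).mul_left (k.factorial : ℝ)).of_nonneg_of_le
    (fun n => by have := hc n; positivity) fun n => ?_
  have h1 : (n : ℝ) ^ k ≤ k.factorial * Real.exp n := by
    have := Real.pow_div_factorial_le_exp (n : ℝ) (by positivity) k
    rwa [div_le_iff₀' (by positivity)] at this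
  have h2 : 0 ≤ c n * t ^ n := mul_nonneg (hc n) (by positivity)
  calc (n : ℝ) ^ k * c n * t ^ n = (n : ℝ) ^ k * (c n * t ^ n) := by ring
    _ ≤ k.factorial * Real.exp n * (c n * t ^ n) := by gcongr
    _ = _ := by
      rw [mul_pow, ← Real.exp_nat_mul, mul_one]
      ring

theorem le_tsum_sq_mul (hc : ∀ n, 0 ≤ c n)
    (hent : ∀ t : ℝ, Summable fun n : ℕ => c n * t ^ n) {t : ℝ} (ht : 0 ≤ t) {n : ℕ} (hn : 0 < n) :
    c n * t ^ n ≤ ∑' n : ℕ, (n : ℝ) ^ 2 * c n * t ^ n := by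
  refine le_trans ?_ ((summable_pow_mul hc hent 2 ht).le_tsum n
    fun j _ => by have := hc j; positivity)
  have h1 : (1 : ℝ) ≤ (n : ℝ) ^ 2 := one_le_pow₀ (by exact_mod_cast hn)
  have h2 : 0 ≤ c n * t ^ n := mul_nonneg (hc n) (by positivity)
  rw [mul_assoc]
  exact le_mul_of_one_le_left h2 h1

theorem tendsto_tsum_sq_mul_atTop (hc : ∀ n, 0 ≤ c n) (hcne : ∃ n, 0 < n ∧ 0 < c n)
    (hent : ∀ t : ℝ, Summable fun n : ℕ => c n * t ^ n) :
    Tendsto (fun t : ℝ => ∑' n : ℕ, (n : ℝ) ^ 2 * c n * t ^ n) atTop atTop := by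
  obtain ⟨n, hn, hcn⟩ := hcne
  refine tendsto_atTop_mono' atTop ?_ ((tendsto_pow_atTop hn.ne').const_mul_atTop hcn)
  filter_upwards [eventually_ge_atTop 0] with t ht using le_tsum_sq_mul hc hent ht hn

theorem tail_term_le (hc : ∀ n, 0 ≤ c n) {t N : ℝ} (ht : 0 ≤ t) {n : ℕ} (hn : N ≤ n) :
    (n : ℝ) ^ 3 * Real.exp n * (c n * t ^ n) ≤
      6 * Real.exp (-N) * (c n * (Real.exp 3 * t) ^ n) := by
  have h1 : (n : ℝ) ^ 3 ≤ 6 * Real.exp n := by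
    have := Real.pow_div_factorial_le_exp (n : ℝ) (by positivity) 3
    rwa [div_le_iff₀' (by positivity)] at this
  have h2 : 0 ≤ c n * t ^ n := mul_nonneg (hc n) (by positivity)
  calc (n : ℝ) ^ 3 * Real.exp n * (c n * t ^ n)
      ≤ 6 * Real.exp n * Real.exp n * (c n * t ^ n) := by gcongr
    _ = 6 * Real.exp (-n) * (c n * (Real.exp 3 * t) ^ n) := by
      rw [mul_pow, ← Real.exp_nat_mul]
      have : Real.exp (n * 3) * Real.exp (-n) = Real.exp n * Real.exp n := by
        rw [← Real.exp_add, ← Real.exp_add]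
        ring_nf
      linear_combination (-6 * c n * t ^ n) * this
    _ ≤ _ := by
      have := hc n
      gcongr

/-- For a series of finite order there is a cutoff, negligible against the standard deviation,
beyond which the terms are negligible as well. -/
theorem exists_cutoff (hc : ∀ n, 0 ≤ c n) (hcne : ∃ n, 0 < n ∧ 0 < c n)
    (hent : ∀ t : ℝ, Summable fun n : ℕ => c n * t ^ n) (ρ : ℝ) :
    ∃ N : ℝ → ℝ, (∀ᶠ t in atTop, 0 ≤ N t) ∧
      Tendsto (fun t => N t / √(∑' n : ℕ, (n : ℝ) ^ 2 * c n * t ^ n)) atTop (𝓝 0) ∧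
      ∀ᶠ t in atTop, ∀ n : ℕ, N t < n → (n : ℝ) ^ 3 * Real.exp n * (c n * t ^ n) ≤
        6 * Real.exp (-(Real.exp 3 * t) ^ ρ) * (c n * (Real.exp 3 * t) ^ n) := by
  by_cases hfin : ∃ d, ∀ n, d < n → c n = 0
  · obtain ⟨d, hd⟩ := hfin
    refine ⟨fun _ => d, Eventually.of_forall fun _ => by positivity,
      tendsto_const_nhds.div_atTop
        (Real.tendsto_sqrt_atTop.comp (tendsto_tsum_sq_mul_atTop hc hcne hent)),
      Eventually.of_forall fun t n hn => ?_⟩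
    rw [hd n (Nat.cast_lt.1 hn)]
    simp
  · push Not at hfin
    refine ⟨fun t => (Real.exp 3 * t) ^ ρ, ?_, ?_, ?_⟩
    · filter_upwards [eventually_ge_atTop 0] with t ht
      positivity
    · obtain ⟨n, hn, hcn⟩ := hfin (⌈2 * ρ + 2⌉₊)
      have hcn : 0 < c n := lt_of_le_of_ne (hc n) hcn.symm
      have hnρ : 2 * ρ + 2 ≤ n := (Nat.le_ceil _).trans (by exact_mod_cast hn.le)
      have hlim : Tendsto (fun t : ℝ => (Real.exp 3) ^ ρ / √(c n) / t) atTop (𝓝 0) :=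
        tendsto_const_nhds.div_atTop tendsto_id
      refine squeeze_zero' ?_ ?_ hlim
      · filter_upwards [eventually_ge_atTop 0] with t ht
        positivity
      · filter_upwards [eventually_ge_atTop 1] with t ht
        have ht0 : 0 < t := by linarith
        have h1 : √(c n) * (t ^ ρ * t) ≤ √(∑' n : ℕ, (n : ℝ) ^ 2 * c n * t ^ n) := by
          refine Real.le_sqrt_of_sq_le ?_
          refine le_trans ?_ (le_tsum_sq_mul hc hent ht0.le (by omega : 0 < n))
          rw [mul_pow, Real.sq_sqrt hcn.le]
          gcongr
          rw [← Real.rpow_add_one ht0.ne', ← Real.rpow_natCast, ← Real.rpow_mul ht0.le,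
            ← Real.rpow_natCast]
          refine Real.rpow_le_rpow_of_exponent_le ht ?_
          push_cast
          linarith
        have hs : 0 < √(c n) := Real.sqrt_pos.2 hcn
        have hr : 0 < t ^ ρ := by positivity
        calc (Real.exp 3 * t) ^ ρ / √(∑' n : ℕ, (n : ℝ) ^ 2 * c n * t ^ n)
            ≤ (Real.exp 3 * t) ^ ρ / (√(c n) * (t ^ ρ * t)) := by gcongr
          _ = _ := by
            rw [Real.mul_rpow (by positivity) ht0.le]
            field_simp
    · filter_upwards [eventually_ge_atTop 0] with t ht n hn
      exact tail_term_le hc ht hn.le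

/-- The normalised cumulant generating function of a series of finite order is asymptotically
quadratic, uniformly on discs. -/
theorem exists_cumulant_bound (hc : ∀ n, 0 ≤ c n) (hcne : ∃ n, 0 < n ∧ 0 < c n)
    (hent : ∀ t : ℝ, Summable fun n : ℕ => c n * t ^ n) {ρ : ℝ}
    (horder : ∀ᶠ t : ℝ in atTop, fsum c t ≤ Real.exp (t ^ ρ)) {B : ℝ} (hB : 0 < B) :
    ∃ ε : ℝ → ℝ, Tendsto ε atTop (𝓝 0) ∧ ∀ᶠ t in atTop, ∀ u : ℂ, ‖u‖ ≤ B →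
      ‖expSeries (fun n => ((c n * t ^ n : ℝ) : ℂ))
          (fun n => n / √(∑' n : ℕ, (n : ℝ) ^ 2 * c n * t ^ n)) u - (fsum c t : ℝ) -
        u * ((∑' n : ℕ, (n : ℝ) * c n * t ^ n) / √(∑' n : ℕ, (n : ℝ) ^ 2 * c n * t ^ n) : ℝ) -
        u ^ 2 / 2‖ ≤ ε t := by
  obtain ⟨N, hN0, hN, htail⟩ := exists_cutoff hc hcne hent ρ
  have hVtop := tendsto_tsum_sq_mul_atTop hc hcne hent
  set V : ℝ → ℝ := fun t => ∑' n : ℕ, (n : ℝ) ^ 2 * c n * t ^ n with hV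
  have hσtop : Tendsto (fun t => √(V t)) atTop atTop := Real.tendsto_sqrt_atTop.comp hVtop
  refine ⟨fun t => B ^ 3 * (N t / √(V t)) * Real.exp (B * (N t / √(V t))) +
    6 * B ^ 3 / √(V t) ^ 3, ?_, ?_⟩
  · have h1 := (hN.const_mul (B ^ 3)).mul ((Real.continuous_exp.tendsto _).comp (hN.const_mul B))
    have h2 : Tendsto (fun t => 6 * B ^ 3 / √(V t) ^ 3) atTop (𝓝 0) :=
      tendsto_const_nhds.div_atTop ((tendsto_pow_atTop three_ne_zero).comp hσtop)
    simpa using h1.add h2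
  · have horder' := (tendsto_id.const_mul_atTop (Real.exp_pos 3)).eventually horder
    filter_upwards [hN0, htail, horder', hσtop.eventually_ge_atTop (max 1 B),
      eventually_ge_atTop 0] with t hNt htailt hordt hσB ht u hu
    have hσ1 : 1 ≤ √(V t) := (le_max_left _ _).trans hσB
    have hσB : B ≤ √(V t) := (le_max_right _ _).trans hσB
    have hσsq : √(V t) ^ 2 = V t := Real.sq_sqrt (Real.sqrt_pos.1 (by linarith)).le
    change ‖expSeries (fun n => ((c n * t ^ n : ℝ) : ℂ)) (fun n => n / √(V t)) u - (fsum c t : ℝ) -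
        u * ((∑' n : ℕ, (n : ℝ) * c n * t ^ n) / √(V t) : ℝ) - u ^ 2 / 2‖ ≤ _
    set σ := √(V t) with hσdef
    have hσ0 : 0 < σ := by linarith
    have hσC : (σ : ℂ) ≠ 0 := by exact_mod_cast hσ0.ne'
    have hp : ∀ n, 0 ≤ c n * t ^ n := fun n => mul_nonneg (hc n) (by positivity)
    have hes : ExpSummable (fun n => ((c n * t ^ n : ℝ) : ℂ)) (fun n => n / σ) := by
      intro r
      refine (hent (t * Real.exp (r / σ))).congr fun n => ?_
      rw [Complex.norm_real, Real.norm_of_nonneg (hp n), abs_of_nonneg (by positivity), mul_pow,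
        ← Real.exp_nat_mul]
      ring_nf
    have s0 : HasSum (fun n => ((c n * t ^ n : ℝ) : ℂ)) (fsum c t : ℝ) :=
      Complex.hasSum_ofReal.2 (hent t).hasSum
    have s1 : HasSum (fun n : ℕ => (((n : ℝ) * c n * t ^ n : ℝ) : ℂ))
        (∑' n : ℕ, (n : ℝ) * c n * t ^ n : ℝ) := by
      have := summable_pow_mul hc hent 1 ht
      simp only [pow_one] at this
      exact Complex.hasSum_ofReal.2 this.hasSum
    have s2r : HasSum (fun n : ℕ => (n : ℝ) ^ 2 * c n * t ^ n) (V t) :=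
      (summable_pow_mul hc hent 2 ht).hasSum
    have s2 : HasSum (fun n : ℕ => (((n : ℝ) ^ 2 * c n * t ^ n : ℝ) : ℂ)) (V t : ℝ) :=
      Complex.hasSum_ofReal.2 s2r
    have hsum := (((hes.summable u).hasSum.sub s0).sub (s1.mul_left (u / σ))).sub
      (s2.mul_left (u ^ 2 / (2 * σ ^ 2)))
    have hW : HasSum (fun n => 6 * Real.exp (-(Real.exp 3 * t) ^ ρ) *
        (c n * (Real.exp 3 * t) ^ n))
        (6 * Real.exp (-(Real.exp 3 * t) ^ ρ) * fsum c (Real.exp 3 * t)) :=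
      (hent _).hasSum.mul_left _
    have hbd := (s2r.mul_left (B ^ 3 * (N t / σ) * Real.exp (B * (N t / σ)) / σ ^ 2)).add
      (hW.mul_left (B ^ 3 / σ ^ 3))
    have hterm : ∀ n : ℕ, ‖((c n * t ^ n : ℝ) : ℂ) * Complex.exp (u * ((n / σ : ℝ) : ℂ)) -
        ((c n * t ^ n : ℝ) : ℂ) - u / σ * (((n : ℝ) * c n * t ^ n : ℝ) : ℂ) -
        u ^ 2 / (2 * σ ^ 2) * (((n : ℝ) ^ 2 * c n * t ^ n : ℝ) : ℂ)‖ ≤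
        B ^ 3 * (N t / σ) * Real.exp (B * (N t / σ)) / σ ^ 2 * ((n : ℝ) ^ 2 * c n * t ^ n) +
        B ^ 3 / σ ^ 3 * (6 * Real.exp (-(Real.exp 3 * t) ^ ρ) *
          (c n * (Real.exp 3 * t) ^ n)) := by
      intro n
      have hW0 : 0 ≤ B ^ 3 / σ ^ 3 * (6 * Real.exp (-(Real.exp 3 * t) ^ ρ) *
          (c n * (Real.exp 3 * t) ^ n)) := by
        have := hc n
        positivity
      have e1 : ((c n * t ^ n : ℝ) : ℂ) * Complex.exp (u * ((n / σ : ℝ) : ℂ)) -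
          ((c n * t ^ n : ℝ) : ℂ) - u / σ * (((n : ℝ) * c n * t ^ n : ℝ) : ℂ) -
          u ^ 2 / (2 * σ ^ 2) * (((n : ℝ) ^ 2 * c n * t ^ n : ℝ) : ℂ) =
          ((c n * t ^ n : ℝ) : ℂ) * (Complex.exp (u * ((n / σ : ℝ) : ℂ)) -
            ∑ m ∈ Finset.range 3, (u * ((n / σ : ℝ) : ℂ)) ^ m / m.factorial) := by
        simp only [Finset.sum_range_succ, Finset.sum_range_zero, Nat.factorial]
        push_cast
        field_simp
        ring
      have e2 : ‖u * ((n / σ : ℝ) : ℂ)‖ ≤ B * (n / σ) := by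
        rw [norm_mul, Complex.norm_real, Real.norm_of_nonneg (by positivity)]
        gcongr
      have e3 : ‖((c n * t ^ n : ℝ) : ℂ) * Complex.exp (u * ((n / σ : ℝ) : ℂ)) -
          ((c n * t ^ n : ℝ) : ℂ) - u / σ * (((n : ℝ) * c n * t ^ n : ℝ) : ℂ) -
          u ^ 2 / (2 * σ ^ 2) * (((n : ℝ) ^ 2 * c n * t ^ n : ℝ) : ℂ)‖ ≤
          c n * t ^ n * ((B * (n / σ)) ^ 3 * Real.exp (B * (n / σ))) := by
        rw [e1, norm_mul, Complex.norm_real, Real.norm_of_nonneg (hp n)]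
        refine mul_le_mul_of_nonneg_left ?_ (hp n)
        refine (Complex.norm_exp_sub_sum_le_norm_mul_exp _ 3).trans ?_
        gcongr
      refine e3.trans ?_
      rcases le_or_gt (n : ℝ) (N t) with hn | hn
      · refine le_add_of_le_of_nonneg ?_ hW0
        calc c n * t ^ n * ((B * (n / σ)) ^ 3 * Real.exp (B * (n / σ)))
            = B ^ 3 * (n / σ) * Real.exp (B * (n / σ)) / σ ^ 2 * (n ^ 2 * (c n * t ^ n)) := by
              field_simp
          _ ≤ B ^ 3 * (N t / σ) * Real.exp (B * (N t / σ)) / σ ^ 2 * (n ^ 2 * (c n * t ^ n)) := by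
              have := hp n
              gcongr
          _ = _ := by ring
      · refine le_add_of_nonneg_of_le ?_ ?_
        · have := hc n
          positivity
        · refine le_trans ?_ (mul_le_mul_of_nonneg_left (htailt n hn) (by positivity))
          have hBn : B * (n / σ) ≤ n := by
            rw [← mul_div_assoc, div_le_iff₀ hσ0, mul_comm]
            gcongr
          calc c n * t ^ n * ((B * (n / σ)) ^ 3 * Real.exp (B * (n / σ)))
              ≤ c n * t ^ n * ((B * (n / σ)) ^ 3 * Real.exp n) := by
                have := hp n
                gcongr
            _ = _ := by
              field_simp
    have hnorm := tsum_of_norm_bounded hbd hterm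
    rw [hsum.tsum_eq] at hnorm
    have hσV : (V t : ℂ) = (σ : ℂ) ^ 2 := by exact_mod_cast hσsq.symm
    have hlhs : expSeries (fun n => ((c n * t ^ n : ℝ) : ℂ)) (fun n => n / σ) u - (fsum c t : ℝ) -
        u * ((∑' n : ℕ, (n : ℝ) * c n * t ^ n) / σ : ℝ) - u ^ 2 / 2 =
        expSeries (fun n => ((c n * t ^ n : ℝ) : ℂ)) (fun n => n / σ) u - (fsum c t : ℝ) -
        u / σ * (∑' n : ℕ, (n : ℝ) * c n * t ^ n : ℝ) - u ^ 2 / (2 * σ ^ 2) * (V t : ℝ) := by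
      rw [hσV, Complex.ofReal_div]
      field_simp
    rw [hlhs]
    refine hnorm.trans (add_le_add (le_of_eq ?_) ?_)
    · rw [← hσsq]
      field_simp
    · have h6 : Real.exp (-(Real.exp 3 * t) ^ ρ) * fsum c (Real.exp 3 * t) ≤ 1 := by
        calc _ ≤ Real.exp (-(Real.exp 3 * t) ^ ρ) * Real.exp ((Real.exp 3 * t) ^ ρ) := by
              gcongr
              exact hordt
          _ = 1 := by rw [← Real.exp_add]; simp
      have : 0 < B ^ 3 / σ ^ 3 := by positivity
      calc _ = 6 * (B ^ 3 / σ ^ 3) * (Real.exp (-(Real.exp 3 * t) ^ ρ) *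
            fsum c (Real.exp 3 * t)) := by ring
        _ ≤ 6 * (B ^ 3 / σ ^ 3) * 1 := by gcongr
        _ = _ := by ring

end GrowthBounds

theorem gaussMoment_add_two (m : ℕ) : gaussMoment (m + 2) = (m + 1) * gaussMoment m := by
  rcases Nat.even_or_odd' m with ⟨j, rfl | rfl⟩
  · have h1 : Even (2 * j) := even_two_mul j
    have h2 : Even (2 * j + 2) := h1.add even_two
    have h3 : (2 * j + 2) / 2 = j + 1 := by omega
    have h4 : 2 * j / 2 = j := by omega
    rw [gaussMoment, gaussMoment, if_pos h1, if_pos h2, h3, h4, Nat.factorial_succ (2 * j + 1),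
      Nat.factorial_succ (2 * j), Nat.factorial_succ j]
    push_cast
    field_simp
    ring
  · have h1 : ¬ Even (2 * j + 1) := by simp
    have h2 : ¬ Even (2 * j + 1 + 2) := by simp [Nat.even_add_one]
    rw [gaussMoment, gaussMoment, if_neg h1, if_neg h2, mul_zero]

theorem iteratedDeriv_gaussian_zero (m : ℕ) :
    iteratedDeriv m (fun u : ℂ => Complex.exp (u ^ 2 / 2)) 0 = (gaussMoment m : ℝ) := by
  induction m using Nat.twoStepInduction with
  | zero => simp [gaussMoment]
  | one =>
    have : HasDerivAt (fun u : ℂ => Complex.exp (u ^ 2 / 2)) 0 0 :=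
      ((((hasDerivAt_id' (0 : ℂ)).pow 2).div_const 2).cexp).congr_deriv (by simp)
    rw [iteratedDeriv_one, this.deriv]
    simp [gaussMoment]
  | more m ih _ =>
    rw [iteratedDeriv_gaussian_add_two, gaussMoment_add_two]
    simp [ih]

theorem expSeries_natCast_ofReal (b : ℕ → ℝ) (k : ℕ) (s : ℝ) :
    expSeries (fun n => (b n : ℂ) * ((n : ℝ) : ℂ) ^ k) (fun n => n) s =
      ((∑' n : ℕ, (n : ℝ) ^ k * b n * Real.exp s ^ n : ℝ) : ℂ) := by
  rw [expSeries, Complex.ofReal_tsum]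
  refine tsum_congr fun n => ?_
  rw [← Real.exp_nat_mul]
  push_cast
  rw [mul_comm (n : ℂ) (s : ℂ)]
  ring

theorem expSeries_natCast_ofReal_zero (b : ℕ → ℝ) (s : ℝ) :
    expSeries (fun n => (b n : ℂ)) (fun n => n) s = (fsum b (Real.exp s) : ℝ) := by
  simpa [fsum] using expSeries_natCast_ofReal b 0 s

theorem expSummable_natCast {b : ℕ → ℝ} (hb : ∀ t : ℝ, 0 ≤ t → Summable fun n => b n * t ^ n) :
    ExpSummable (fun n => (b n : ℂ)) (fun n => n) := by
  intro r
  refine (hb (Real.exp r) (Real.exp_pos r).le).abs.congr fun n => ?_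
  rw [Complex.norm_real, Real.norm_eq_abs, abs_mul, Nat.abs_cast, ← Real.exp_nat_mul,
    Real.abs_exp, mul_comm r]

section Exponential

variable {c a : ℕ → ℝ}

theorem expSeries_eq_exp (hent : ∀ t : ℝ, Summable fun n : ℕ => c n * t ^ n)
    (ha : ∀ t : ℝ, 0 ≤ t → HasSum (fun n : ℕ => a n * t ^ n) (Real.exp (fsum c t))) :
    expSeries (fun n => (a n : ℂ)) (fun n => n) =
      fun z => Complex.exp (expSeries (fun n => (c n : ℂ)) (fun n => n) z) := by
  have hA := (expSummable_natCast fun t ht => (ha t ht).summable).differentiable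
  have hG := (expSummable_natCast fun t _ => hent t).differentiable
  have hlim : Tendsto (fun x : ℝ => (x : ℂ)) (𝓝[≠] 0) (𝓝[≠] 0) := by
    refine tendsto_nhdsWithin_iff.2 ⟨?_, ?_⟩
    · simpa using (Complex.continuous_ofReal.tendsto 0).mono_left nhdsWithin_le_nhds
    · filter_upwards [self_mem_nhdsWithin] with x hx
      simpa using hx
  refine AnalyticOnNhd.eq_of_frequently_eq (z₀ := 0)
    (Complex.analyticOnNhd_univ_iff_differentiable.2 hA)
    (Complex.analyticOnNhd_univ_iff_differentiable.2 hG.cexp) (hlim.frequently ?_)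
  refine Frequently.of_forall fun s => ?_
  rw [expSeries_natCast_ofReal_zero, expSeries_natCast_ofReal_zero, fsum,
    (ha _ (Real.exp_pos s).le).tsum_eq, Complex.ofReal_exp]

theorem fsum_eq_exp
    (ha : ∀ t : ℝ, 0 ≤ t → HasSum (fun n : ℕ => a n * t ^ n) (Real.exp (fsum c t)))
    {t : ℝ} (ht : 0 < t) : fsum a t = Real.exp (fsum c t) :=
  (ha t ht.le).tsum_eq

theorem first_second_moment_eq (hent : ∀ t : ℝ, Summable fun n : ℕ => c n * t ^ n)
    (ha : ∀ t : ℝ, 0 ≤ t → HasSum (fun n : ℕ => a n * t ^ n) (Real.exp (fsum c t)))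
    {t : ℝ} (ht : 0 < t) :
    ∑' n : ℕ, (n : ℝ) * a n * t ^ n =
        Real.exp (fsum c t) * ∑' n : ℕ, (n : ℝ) * c n * t ^ n ∧
      ∑' n : ℕ, (n : ℝ) ^ 2 * a n * t ^ n =
        Real.exp (fsum c t) * ((∑' n : ℕ, (n : ℝ) * c n * t ^ n) ^ 2 +
          ∑' n : ℕ, (n : ℝ) ^ 2 * c n * t ^ n) := by
  have hA := expSummable_natCast fun t ht => (ha t ht).summable
  have hG := expSummable_natCast fun t _ => hent t
  have h1 : expSeries (fun n => (a n : ℂ) * ((n : ℝ) : ℂ) ^ 1) (fun n => n) = fun z =>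
      Complex.exp (expSeries (fun n => (c n : ℂ)) (fun n => n) z) *
        expSeries (fun n => (c n : ℂ) * ((n : ℝ) : ℂ) ^ 1) (fun n => n) z := by
    funext z
    have hd := hA.hasDerivAt z
    rw [expSeries_eq_exp hent ha] at hd
    simpa only [pow_one] using hd.unique (hG.hasDerivAt z).cexp
  have h2 : expSeries (fun n => (a n : ℂ) * ((n : ℝ) : ℂ) ^ 2) (fun n => n) = fun z =>
      Complex.exp (expSeries (fun n => (c n : ℂ)) (fun n => n) z) *
        (expSeries (fun n => (c n : ℂ) * ((n : ℝ) : ℂ) ^ 1) (fun n => n) z ^ 2 +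
        expSeries (fun n => (c n : ℂ) * ((n : ℝ) : ℂ) ^ 2) (fun n => n) z) := by
    funext z
    have hd := (hA.mul_exponent_pow 1).hasDerivAt z
    rw [h1] at hd
    have := hd.unique ((hG.hasDerivAt z).cexp.mul ((hG.mul_exponent_pow 1).hasDerivAt z))
    simp only [pow_one, mul_assoc, pow_two] at this ⊢
    rw [this]
    ring
  have h1' := congrFun h1 (Real.log t : ℝ)
  have h2' := congrFun h2 (Real.log t : ℝ)
  simp only [expSeries_natCast_ofReal, expSeries_natCast_ofReal_zero, Real.exp_log ht] at h1' h2'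
  constructor
  · simp only [pow_one] at h1'
    exact_mod_cast h1'
  · simp only [pow_one] at h2'
    exact_mod_cast h2'

theorem mf_eq (hent : ∀ t : ℝ, Summable fun n : ℕ => c n * t ^ n)
    (ha : ∀ t : ℝ, 0 ≤ t → HasSum (fun n : ℕ => a n * t ^ n) (Real.exp (fsum c t)))
    {t : ℝ} (ht : 0 < t) : mf a t = ∑' n : ℕ, (n : ℝ) * c n * t ^ n := by
  rw [mf, (first_second_moment_eq hent ha ht).1, fsum_eq_exp ha ht,
    mul_div_cancel_left₀ _ (Real.exp_pos _).ne']

theorem sigma_eq (hent : ∀ t : ℝ, Summable fun n : ℕ => c n * t ^ n)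
    (ha : ∀ t : ℝ, 0 ≤ t → HasSum (fun n : ℕ => a n * t ^ n) (Real.exp (fsum c t)))
    {t : ℝ} (ht : 0 < t) : sigma a t = √(∑' n : ℕ, (n : ℝ) ^ 2 * c n * t ^ n) := by
  rw [sigma, sigma2, mf_eq hent ha ht, (first_second_moment_eq hent ha ht).2, fsum_eq_exp ha ht,
    mul_div_cancel_left₀ _ (Real.exp_pos _).ne', add_sub_cancel_left]

/-- Moment generating function of the normalised variable, as a function of a complex variable. -/
noncomputable def normMGF (a : ℕ → ℝ) (t : ℝ) : ℂ → ℂ :=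
  expSeries (fun n => ((a n * t ^ n / fsum a t : ℝ) : ℂ)) fun n => (n - mf a t) / sigma a t

theorem expSummable_normMGF
    (ha : ∀ t : ℝ, 0 ≤ t → HasSum (fun n : ℕ => a n * t ^ n) (Real.exp (fsum c t)))
    {t : ℝ} (ht : 0 < t) :
    ExpSummable (fun n => ((a n * t ^ n / fsum a t : ℝ) : ℂ))
      fun n => (n - mf a t) / sigma a t := by
  intro r
  have hs := ((ha (t * Real.exp (|r| / |sigma a t|)) (by positivity)).summable.abs.mul_left
    (|fsum a t|⁻¹ * Real.exp (|r| / |sigma a t| * |mf a t|)))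
  refine hs.of_nonneg_of_le (fun n => by positivity) fun n => ?_
  have h1 : r * |((n : ℝ) - mf a t) / sigma a t| ≤
      n * (|r| / |sigma a t|) + |r| / |sigma a t| * |mf a t| := by
    have h2 : |(n : ℝ) - mf a t| ≤ n + |mf a t| := by
      simpa using abs_sub (n : ℝ) (mf a t)
    calc r * |((n : ℝ) - mf a t) / sigma a t| ≤ |r| * (|(n : ℝ) - mf a t| / |sigma a t|) := by
          rw [abs_div]
          gcongr
          exact le_abs_self r
      _ ≤ |r| * ((n + |mf a t|) / |sigma a t|) := by gcongr
      _ = _ := by ring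
  calc ‖((a n * t ^ n / fsum a t : ℝ) : ℂ)‖ * Real.exp (r * |((n : ℝ) - mf a t) / sigma a t|)
      ≤ ‖((a n * t ^ n / fsum a t : ℝ) : ℂ)‖ *
        Real.exp (n * (|r| / |sigma a t|) + |r| / |sigma a t| * |mf a t|) := by gcongr
    _ = _ := by
      rw [Complex.norm_real, Real.norm_eq_abs, abs_div, abs_mul, abs_mul, mul_pow, abs_mul,
        ← Real.exp_nat_mul, Real.abs_exp, Real.exp_add]
      ring

theorem normMGF_eq (hent : ∀ t : ℝ, Summable fun n : ℕ => c n * t ^ n)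
    (ha : ∀ t : ℝ, 0 ≤ t → HasSum (fun n : ℕ => a n * t ^ n) (Real.exp (fsum c t)))
    {t : ℝ} (ht : 0 < t) (u : ℂ) :
    normMGF a t u = Complex.exp (expSeries (fun n => ((c n * t ^ n : ℝ) : ℂ))
      (fun n => n / √(∑' n : ℕ, (n : ℝ) ^ 2 * c n * t ^ n)) u - (fsum c t : ℝ) -
      u * ((∑' n : ℕ, (n : ℝ) * c n * t ^ n) /
        √(∑' n : ℕ, (n : ℝ) ^ 2 * c n * t ^ n) : ℝ)) := by
  have hshift : ∀ (b : ℕ → ℝ) (σ : ℝ), expSeries (fun n => ((b n * t ^ n : ℝ) : ℂ))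
      (fun n => n / σ) u = expSeries (fun n => (b n : ℂ)) (fun n => n) (Real.log t + u / σ) := by
    intro b σ
    refine tsum_congr fun n => ?_
    have : (t : ℂ) ^ n = Complex.exp (Real.log t * ((n : ℝ) : ℂ)) := by
      conv_lhs => rw [← Real.exp_log ht]
      rw [Complex.ofReal_exp, ← Complex.exp_nat_mul, mul_comm]
      simp
    push_cast
    rw [this, mul_assoc, ← Complex.exp_add]
    push_cast
    ring_nf
  rw [← sigma_eq hent ha ht, ← mf_eq hent ha ht, hshift, sub_right_comm, Complex.exp_sub,
    Complex.exp_sub, ← congrFun (expSeries_eq_exp hent ha) (Real.log t + u / sigma a t), ← hshift,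
    ← Complex.ofReal_exp, ← fsum_eq_exp ha ht, normMGF, expSeries, expSeries, ← tsum_div_const,
    ← tsum_div_const]
  refine tsum_congr fun n => ?_
  have : u * (((n - mf a t) / sigma a t : ℝ) : ℂ) =
      u * ((n / sigma a t : ℝ) : ℂ) - u * ((mf a t / sigma a t : ℝ) : ℂ) := by
    push_cast
    ring
  rw [this, Complex.exp_sub]
  push_cast
  ring

theorem tendstoLocallyUniformlyOn_cumulant (hc : ∀ n, 0 ≤ c n) (hcne : ∃ n, 0 < n ∧ 0 < c n)
    (hent : ∀ t : ℝ, Summable fun n : ℕ => c n * t ^ n) {ρ : ℝ}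
    (horder : ∀ᶠ t : ℝ in atTop, fsum c t ≤ Real.exp (t ^ ρ)) :
    TendstoLocallyUniformlyOn (fun (t : ℝ) (u : ℂ) =>
      expSeries (fun n => ((c n * t ^ n : ℝ) : ℂ))
        (fun n => n / √(∑' n : ℕ, (n : ℝ) ^ 2 * c n * t ^ n)) u - (fsum c t : ℝ) -
        u * ((∑' n : ℕ, (n : ℝ) * c n * t ^ n) / √(∑' n : ℕ, (n : ℝ) ^ 2 * c n * t ^ n) : ℝ))
      (fun u => u ^ 2 / 2) atTop Set.univ := by
  rw [tendstoLocallyUniformlyOn_iff_forall_isCompact isOpen_univ]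
  intro K _ hK
  obtain ⟨B, hB, hKB⟩ := hK.isBounded.exists_pos_norm_le
  obtain ⟨ε, hε, hbound⟩ := exists_cumulant_bound hc hcne hent horder hB
  rw [Metric.tendstoUniformlyOn_iff]
  intro δ hδ
  filter_upwards [hbound, hε.eventually_lt_const hδ] with t ht htδ u hu
  rw [dist_comm, dist_eq_norm]
  exact (ht u (hKB u hu)).trans_lt htδ

theorem tendstoLocallyUniformlyOn_normMGF (hc : ∀ n, 0 ≤ c n) (hcne : ∃ n, 0 < n ∧ 0 < c n)
    (hent : ∀ t : ℝ, Summable fun n : ℕ => c n * t ^ n) {ρ : ℝ}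
    (horder : ∀ᶠ t : ℝ in atTop, fsum c t ≤ Real.exp (t ^ ρ))
    (ha : ∀ t : ℝ, 0 ≤ t → HasSum (fun n : ℕ => a n * t ^ n) (Real.exp (fsum c t))) :
    TendstoLocallyUniformlyOn (normMGF a) (fun u => Complex.exp (u ^ 2 / 2)) atTop Set.univ := by
  have h := tendstoLocallyUniformlyOn_cumulant hc hcne hent horder
  rw [tendstoLocallyUniformlyOn_iff_forall_isCompact isOpen_univ] at h ⊢
  intro K hKu hK
  refine ((h K hKu hK).comp_cexp
    (hK.bddAbove_image (Continuous.continuousOn (by fun_prop)))).congr ?_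
  filter_upwards [eventually_gt_atTop 0] with t ht u _
  exact (normMGF_eq hent ha ht u).symm

theorem tendsto_Fq (hc : ∀ n, 0 ≤ c n) (hcne : ∃ n, 0 < n ∧ 0 < c n)
    (hent : ∀ t : ℝ, Summable fun n : ℕ => c n * t ^ n) {ρ : ℝ}
    (horder : ∀ᶠ t : ℝ in atTop, fsum c t ≤ Real.exp (t ^ ρ))
    (ha : ∀ t : ℝ, 0 ≤ t → HasSum (fun n : ℕ => a n * t ^ n) (Real.exp (fsum c t)))
    {k : ℕ} (hk : 3 ≤ k) : Tendsto (fun s => Fq a k s) atTop (𝓝 0) := by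
  obtain ⟨j, rfl⟩ : ∃ j, k = j + 3 := ⟨k - 3, by omega⟩
  have hes : ∀ t : ℝ, 0 < t → ExpSummable (fun n => ((c n * t ^ n : ℝ) : ℂ))
      (fun n => n / √(∑' n : ℕ, (n : ℝ) ^ 2 * c n * t ^ n)) := by
    intro t ht r
    refine (hent (t * Real.exp (r / √(∑' n : ℕ, (n : ℝ) ^ 2 * c n * t ^ n)))).congr fun n => ?_
    rw [Complex.norm_real, Real.norm_of_nonneg (mul_nonneg (hc n) (by positivity)),
      abs_of_nonneg (by positivity), mul_pow, ← Real.exp_nat_mul]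
    ring_nf
  have hlim := ((tendstoLocallyUniformlyOn_cumulant hc hcne hent horder).iteratedDeriv_univ
    (by
      filter_upwards [eventually_gt_atTop 0] with t ht
      exact ((hes t ht).differentiable.sub_const _).sub (differentiable_id.mul_const _))
    (j + 3)).tendsto_at (Set.mem_univ 0)
  rw [iteratedDeriv_sq_div_two_add_three] at hlim
  have hlim' : Tendsto (fun t : ℝ => (((∑' n : ℕ, (n : ℝ) ^ (j + 3) * c n * t ^ n) /
      √(∑' n : ℕ, (n : ℝ) ^ 2 * c n * t ^ n) ^ (j + 3) : ℝ) : ℂ)) atTop (𝓝 ((0 : ℝ) : ℂ)) := by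
    refine Tendsto.congr' ?_ hlim
    filter_upwards [eventually_gt_atTop 0] with t ht
    rw [(hes t ht).iteratedDeriv_sub_affine _ _ (j + 1), expSeries_zero, ← tsum_div_const,
      Complex.ofReal_tsum]
    refine tsum_congr fun n => ?_
    push_cast
    rw [div_pow]
    ring
  have hreal := (Complex.continuous_re.tendsto _).comp hlim'
  refine (hreal.comp Real.tendsto_exp_atTop).congr fun s => ?_
  have hful : fulcrum a = fun s : ℝ => (expSeries (fun n => (c n : ℂ)) (fun n => n) s).re := by
    funext s
    rw [expSeries_natCast_ofReal_zero, fulcrum, fsum_eq_exp ha (Real.exp_pos s), Real.log_exp,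
      Complex.ofReal_re]
  have hG := expSummable_natCast fun t _ => hent t
  have hV : 0 ≤ ∑' n : ℕ, (n : ℝ) ^ 2 * c n * Real.exp s ^ n :=
    tsum_nonneg fun n => by have := hc n; positivity
  simp only [Function.comp_apply, Complex.ofReal_re]
  rw [Fq, hful, hG.iteratedDeriv_re_eq, hG.iteratedDeriv_re_eq]
  simp only [expSeries_natCast_ofReal, Complex.ofReal_re]
  rw [Real.sqrt_eq_rpow, ← Real.rpow_mul_natCast hV]
  congr 2
  ring

theorem tendsto_normMoment (hc : ∀ n, 0 ≤ c n) (hcne : ∃ n, 0 < n ∧ 0 < c n)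
    (hent : ∀ t : ℝ, Summable fun n : ℕ => c n * t ^ n) {ρ : ℝ}
    (horder : ∀ᶠ t : ℝ in atTop, fsum c t ≤ Real.exp (t ^ ρ))
    (ha : ∀ t : ℝ, 0 ≤ t → HasSum (fun n : ℕ => a n * t ^ n) (Real.exp (fsum c t))) (m : ℕ) :
    Tendsto (fun t => normMoment a t m) atTop (𝓝 (gaussMoment m)) := by
  have hlim := ((tendstoLocallyUniformlyOn_normMGF hc hcne hent horder ha).iteratedDeriv_univ
    (by
      filter_upwards [eventually_gt_atTop 0] with t ht
      exact (expSummable_normMGF ha ht).differentiable) m).tendsto_at (Set.mem_univ 0)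
  rw [iteratedDeriv_gaussian_zero] at hlim
  refine ((Complex.continuous_re.tendsto _).comp hlim).congr' ?_
  filter_upwards [eventually_gt_atTop 0] with t ht
  rw [Function.comp_apply, normMGF, (expSummable_normMGF ha ht).iteratedDeriv_eq, expSeries_zero,
    ← Complex.ofReal_re (normMoment a t m), normMoment, Complex.ofReal_tsum]
  simp only [Complex.ofReal_mul, Complex.ofReal_pow]

theorem isGaussianEntire_of_finite_order (hc : ∀ n, 0 ≤ c n) (hcne : ∃ n, 0 < n ∧ 0 < c n)
    (hent : ∀ t : ℝ, Summable fun n : ℕ => c n * t ^ n) {ρ : ℝ}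
    (horder : ∀ᶠ t : ℝ in atTop, fsum c t ≤ Real.exp (t ^ ρ))
    (ha : ∀ t : ℝ, 0 ≤ t → HasSum (fun n : ℕ => a n * t ^ n) (Real.exp (fsum c t))) :
    IsGaussianEntire a := by
  intro θ
  have hlim := (tendstoLocallyUniformlyOn_normMGF hc hcne hent horder ha).tendsto_at
    (Set.mem_univ (Complex.I * θ))
  rwa [mul_pow, Complex.I_sq, neg_one_mul] at hlim

end Exponential

/-- if `g` is a non-constant entire function with non-negative coefficients
`c` and finite order `ρ ≥ 0`, then `f = e^g` (with coefficients `a`) satisfies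
`F^{(k)}(s)/F''(s)^{k/2} → 0` for every `k ≥ 3`, all integer moments of `X̆_t` converge to
the standard normal moments, and `f` is Gaussian. -/
theorem statement19 (c : ℕ → ℝ) (hc : ∀ n, 0 ≤ c n) (hcne : ∃ n, 0 < n ∧ 0 < c n)
    (hent : ∀ t : ℝ, Summable fun n : ℕ => c n * t ^ n)
    (ρ : ℝ) (hρ : 0 ≤ ρ)
    (horder : ∀ᶠ t : ℝ in atTop, fsum c t ≤ Real.exp (t ^ ρ))
    (a : ℕ → ℝ)
    (ha : ∀ t : ℝ, 0 ≤ t → HasSum (fun n : ℕ => a n * t ^ n) (Real.exp (fsum c t))) :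
    (∀ k : ℕ, 3 ≤ k → Tendsto (fun s => Fq a k s) atTop (𝓝 0)) ∧
    (∀ m : ℕ, 1 ≤ m → Tendsto (fun t => normMoment a t m) atTop (𝓝 (gaussMoment m))) ∧
    IsGaussianEntire a :=
  ⟨fun _ hk => tendsto_Fq hc hcne hent horder ha hk,
    fun m _ => tendsto_normMoment hc hcne hent horder ha m,
    isGaussianEntire_of_finite_order hc hcne hent horder ha⟩

end KhinchinPaper
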